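/- arXiv:1805.08164 — 6 statements merged into one kernel-verified Lean document; each statement's English description precedes it below -/
import Mathlib

section
/- Let T be a tree of height ω₁ with no uncountable chains, and let ⟨x_α : α < ω₁⟩ be a pairwise disjoint sequence of finite subsets of T. Then there is a countably infinite set A ⊆ ω₁ such that for all α < β in A, every member of x_α is incomparable in T with every member of x_β. -/
noncomputable section

open Set

/-- The first uncountable ordinal. -/
def omega1 : Ordinal.{0} := (Cardinal.aleph 1).ord

/-- `C` is a closed unbounded subset of `ω₁`. -/
def IsClubOmega1 (C : Set Ordinal) : Prop :=
  C ⊆ Set.Iio omega1 ∧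
  (∀ α < omega1, ∃ β ∈ C, α < β) ∧
  (∀ α < omega1, α ≠ 0 → (∀ β < α, ∃ γ ∈ C, β < γ ∧ γ < α) → α ∈ C)

/-- `S` is a stationary subset of `ω₁`. -/
def IsStationaryOmega1 (S : Set Ordinal) : Prop :=
  S ⊆ Set.Iio omega1 ∧ ∀ C, IsClubOmega1 C → (S ∩ C).Nonempty

/-- A tree: the predecessors of every element are well-ordered. -/
def IsTree (T : Type) [PartialOrder T] : Prop :=
  ∀ x : T, IsWellOrder {y : T // y < x} (fun a b => (a : T) < (b : T))

/-- The height of a node: the order type of its set of predecessors. -/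
def treeHt {T : Type} [PartialOrder T] (h : IsTree T) (x : T) : Ordinal :=
  @Ordinal.type {y : T // y < x} (fun a b => (a : T) < (b : T)) (h x)

/-- A family, indexed by an uncountable type, of pairwise disjoint `κ`-tuples with `κ` finite, in a
forest with countable initial segments and no uncountable chains, has infinitely many members that
are pairwise completely incomparable. -/
theorem exists_infinite_pairwise_incomparable_of_tuples {T ι κ : Type*} [PartialOrder T]
    [Uncountable ι] [Finite κ] (hpred : ∀ a : T, (Iic a).Countable)
    (hforest : ∀ a : T, IsChain (· ≤ ·) (Iic a))
    (hchains : ∀ C : Set T, IsChain (· ≤ ·) C → C.Countable)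
    (e : ι → κ → T) (hdisj : ∀ i j, i ≠ j → ∀ k l, e i k ≠ e j l) :
    ∃ A : Set ι, A.Countable ∧ A.Infinite ∧
      A.Pairwise fun i j => ∀ k l, ¬ e i k ≤ e j l ∧ ¬ e j l ≤ e i k := by
  have hne : (Filter.cocountable : Filter ι).NeBot := by
    refine ⟨fun h => not_countable_univ (α := ι) ?_⟩
    simpa using Filter.mem_cocountable.1 (h ▸ Filter.mem_bot : (∅ : Set ι) ∈ Filter.cocountable)
  obtain ⟨U, hU⟩ := Ultrafilter.exists_le (Filter.cocountable : Filter ι)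
  have hmem {s : Set ι} (hs : s.Countable) : sᶜ ∈ U :=
    hU (Filter.mem_cocountable.2 (by rwa [compl_compl]))
  let good (i j : ι) : Prop := ∀ k l, ¬ e i k ≤ e j l ∧ ¬ e j l ≤ e i k
  let B : Set ι := {i | ¬ ∀ᶠ j in U, good i j}
  have hbelow (a : T) : {j | ∃ l, e j l ≤ a}.Countable := by
    have h : {j | ∃ l, e j l ≤ a} = ⋃ l, {j | e j l ≤ a} := by ext; simp
    rw [h]
    refine countable_iUnion fun l => MapsTo.countable_of_injOn (f := fun j => e j l)
      (fun j hj => hj) ?_ (hpred a)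
    intro i _ j _ hij
    by_contra hne
    exact hdisj i j hne l l hij
  have habove : ∀ i ∈ B, ∃ l k, ∀ᶠ j in U, e i k ≤ e j l := by
    intro i hi
    have h1 : ∀ᶠ j in U, ¬ good i j := Ultrafilter.eventually_not.2 hi
    have h2 : ∀ᶠ j in U, ∃ l k, e i k ≤ e j l := by
      filter_upwards [h1, hmem (countable_iUnion fun k => hbelow (e i k))] with j hj hj'
      by_contra! hcon
      exact hj fun k l => ⟨hcon l k, fun hle => hj' (mem_iUnion.2 ⟨k, l, hle⟩)⟩
    simpa only [Ultrafilter.eventually_exists_iff] using h2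
  have hB : B.Countable := by
    refine .mono (s₂ := ⋃ l, {i | ∃ k, ∀ᶠ j in U, e i k ≤ e j l})
      (fun i hi => mem_iUnion.2 (habove i hi)) (countable_iUnion fun l => ?_)
    have : Nonempty κ := ⟨l⟩
    choose! f hf using fun (i : ι) (hi : ∃ k, ∀ᶠ j in U, e i k ≤ e j l) => hi
    refine MapsTo.countable_of_injOn (f := fun i => e i (f i)) (mapsTo_image _ _) ?_ (hchains _ ?_)
    · intro i _ j _ hij
      by_contra hne
      exact hdisj i j hne _ _ hij
    · rintro _ ⟨i, hi, rfl⟩ _ ⟨j, hj, rfl⟩ hne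
      obtain ⟨m, hm, hm'⟩ := ((hf i hi).and (hf j hj)).exists
      exact hforest _ hm hm' hne
  obtain ⟨s, -, hs⟩ := exists_seq_of_forall_finset_exists (· ∉ B) (fun i j => i ≠ j ∧ good i j) <| by
    intro F hF
    have h : ∀ᶠ j in U, ∀ i ∈ F, i ≠ j ∧ good i j := by
      rw [Filter.eventually_all_finset]
      intro i hi
      refine Filter.Eventually.and ?_ (not_not.1 (hF i hi))
      filter_upwards [hmem (countable_singleton i)] with j hj using fun h => hj h.symm
    exact ((Filter.eventually_of_mem (hmem hB) fun _ => id).and h).exists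
  have hinj : Function.Injective s := by
    intro m n hmn
    rcases lt_trichotomy m n with h | h | h
    · exact absurd hmn (hs m n h).1
    · exact h
    · exact absurd hmn.symm (hs n m h).1
  refine ⟨range s, countable_range s, infinite_range_of_injective hinj, ?_⟩
  rintro _ ⟨m, rfl⟩ _ ⟨n, rfl⟩ hne
  rcases lt_trichotomy m n with h | rfl | h
  · exact (hs m n h).2
  · exact absurd rfl hne
  · exact fun k l => ((hs n m h).2 l k).symm

/-- A pairwise disjoint family of finite sets, indexed by an uncountable type, in a forest with
countable initial segments and no uncountable chains, has infinitely many members that are pairwise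
completely incomparable. -/
theorem exists_infinite_pairwise_incomparable_of_finsets {T ι : Type*} [PartialOrder T]
    [Uncountable ι] (hpred : ∀ a : T, (Iic a).Countable)
    (hforest : ∀ a : T, IsChain (· ≤ ·) (Iic a))
    (hchains : ∀ C : Set T, IsChain (· ≤ ·) C → C.Countable)
    (x : ι → Finset T) (hdisj : ∀ i j, i ≠ j → Disjoint (x i) (x j)) :
    ∃ A : Set ι, A.Countable ∧ A.Infinite ∧
      A.Pairwise fun i j => ∀ a ∈ x i, ∀ b ∈ x j, ¬ a ≤ b ∧ ¬ b ≤ a := by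
  obtain ⟨n, hn⟩ : ∃ n, ¬ {i | (x i).card = n}.Countable := by
    by_contra! h
    refine not_countable_univ (α := ι) ((countable_iUnion h).mono fun i _ => ?_)
    simp
  have : Uncountable {i // (x i).card = n} := not_countable_iff.1 fun h => hn h
  let e (i : {i // (x i).card = n}) : Fin n ≃ x i := ((x i).equivFinOfCardEq i.2).symm
  obtain ⟨A, hA, hA', hpair⟩ := exists_infinite_pairwise_incomparable_of_tuples hpred hforest
    hchains (fun i k => (e i k : T)) fun i j hij k l h =>
      Finset.disjoint_left.1 (hdisj i j (Subtype.coe_ne_coe.2 hij)) (e i k).2 (h ▸ (e j l).2)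
  refine ⟨Subtype.val '' A, hA.image _, hA'.image Subtype.val_injective.injOn, ?_⟩
  rintro _ ⟨i, hi, rfl⟩ _ ⟨j, hj, rfl⟩ hne a ha b hb
  simpa using hpair hi hj (fun h => hne (congrArg _ h)) ((e i).symm ⟨a, ha⟩) ((e j).symm ⟨b, hb⟩)

theorem IsTree.isChain_Iic {T : Type} [PartialOrder T] (h : IsTree T) (a : T) :
    IsChain (· ≤ ·) (Iic a) := by
  intro b hb c hc hne
  rcases hb.eq_or_lt with rfl | hb
  · exact Or.inr hc
  rcases hc.eq_or_lt with rfl | hc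
  · exact Or.inl hb.le
  have := h a
  rcases trichotomous_of (fun p q : {y : T // y < a} => (p : T) < q) ⟨b, hb⟩ ⟨c, hc⟩ with h | h | h
  · exact Or.inl h.le
  · exact absurd (congrArg Subtype.val h) hne
  · exact Or.inr h.le

theorem countable_Iic_of_treeHt_lt_omega1 {T : Type} [PartialOrder T] (h : IsTree T) {a : T}
    (ha : treeHt h a < omega1) : (Iic a).Countable := by
  have := h a
  have hlt : (Iio a).Countable := by
    rw [omega1, Cardinal.lt_ord, treeHt, Ordinal.card_type] at ha
    rw [← Cardinal.le_aleph0_iff_set_countable]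
    rwa [← Cardinal.succ_aleph0, Order.lt_succ_iff] at ha
  rw [← Iio_insert]
  exact hlt.insert a

theorem uncountable_Iio_omega1 : Uncountable (Iio omega1) := by
  rw [← Cardinal.aleph0_lt_mk_iff, Cardinal.mk_Iio_ordinal, omega1, Cardinal.card_ord]
  simp

/-- Baumgartner–Malitz–Reinhardt, infinite form: given a pairwise disjoint sequence
of finite subsets of a tree of height ω₁ with no uncountable chains, there is a
countably infinite set of indices whose corresponding finite sets are pairwise
completely incomparable. -/
theorem exists_countably_infinite_pairwise_incomparable
    (T : Type) [PartialOrder T] (htree : IsTree T)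
    (hlt : ∀ x : T, treeHt htree x < omega1)
    (hunb : ∀ α < omega1, ∃ x : T, treeHt htree x = α)
    (hchains : ∀ C : Set T, IsChain (· ≤ ·) C → C.Countable)
    (x : Ordinal → Finset T)
    (hdisj : ∀ α < omega1, ∀ β < omega1, α ≠ β → Disjoint (x α) (x β)) :
    ∃ A : Set Ordinal, A ⊆ Set.Iio omega1 ∧ A.Countable ∧ A.Infinite ∧
      ∀ α ∈ A, ∀ β ∈ A, α < β →
        ∀ a ∈ x α, ∀ b ∈ x β, ¬ a ≤ b ∧ ¬ b ≤ a := by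
  have := uncountable_Iio_omega1
  obtain ⟨A, hA, hA', hpair⟩ := exists_infinite_pairwise_incomparable_of_finsets
    (fun a => countable_Iic_of_treeHt_lt_omega1 htree (hlt a)) htree.isChain_Iic hchains
    (fun i : Iio omega1 => x i)
    fun i j hij => hdisj i i.2 j j.2 (Subtype.coe_ne_coe.2 hij)
  refine ⟨Subtype.val '' A, ?_, hA.image _, hA'.image Subtype.val_injective.injOn, ?_⟩
  · rintro _ ⟨i, -, rfl⟩
    exact i.2
  · rintro _ ⟨i, hi, rfl⟩ _ ⟨j, hj, rfl⟩ hlt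
    exact hpair hi hj (fun h => hlt.ne (congrArg _ h))
end
end

section
/- Let T be an ω₁-tree and ⟨y_n : n < ω⟩ a sequence such that: (1) each y_n is a finite subset of T; (2) for all m < n, every x ∈ y_m and z ∈ y_n satisfy ht_T(x) < ht_T(z) and x and z are incomparable in T. Let y be a finite subset of T such that for all n < ω, every node of y_n has height less than the height of every node in y. Then there exists n < ω such that every member of y_n is incomparable in T with every member of y. -/
noncomputable section

open Set

/-- The height function of a tree is monotone. -/
theorem treeHt_mono {T : Type} [PartialOrder T] (h : IsTree T) {x z : T} (hxz : x ≤ z) :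
    treeHt h x ≤ treeHt h z := by
  have := h x
  have := h z
  exact RelEmbedding.ordinal_type_le
    (⟨⟨fun w => ⟨w.1, w.2.trans_le hxz⟩, fun _ _ e => Subtype.ext (Subtype.mk.inj e)⟩, Iff.rfl⟩ :
      (fun a b : {w : T // w < x} => (a : T) < (b : T)) ↪r
        (fun a b : {w : T // w < z} => (a : T) < (b : T)))

/-- Any two predecessors of a node of a tree are comparable. -/
theorem IsTree.le_or_le_of_lt {T : Type} [PartialOrder T] (h : IsTree T) {a c b : T}
    (ha : a < b) (hc : c < b) : a ≤ c ∨ c ≤ a := by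
  have := h b
  rcases trichotomous_of (fun u v : {w : T // w < b} => (u : T) < (v : T)) ⟨a, ha⟩ ⟨c, hc⟩
    with hlt | heq | hgt
  · exact Or.inl (le_of_lt hlt)
  · exact Or.inl (le_of_eq (congrArg Subtype.val heq))
  · exact Or.inr (le_of_lt hgt)

/-- If ⟨yₙ : n < ω⟩ is a sequence of finite subsets of an ω₁-tree which are
pairwise completely incomparable with increasing heights, and y is a finite
subset of the tree all of whose nodes have height above all nodes of every yₙ,
then some yₙ is completely incomparable with y. -/
theorem exists_incomparable_level
    (T : Type) [PartialOrder T] (htree : IsTree T)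
    (hlt : ∀ x : T, treeHt htree x < omega1)
    (hunb : ∀ α < omega1, ∃ x : T, treeHt htree x = α)
    (hlevels : ∀ α : Ordinal, {x : T | treeHt htree x = α}.Countable)
    (y : ℕ → Finset T)
    (hseq : ∀ m n : ℕ, m < n → ∀ a ∈ y m, ∀ b ∈ y n,
      treeHt htree a < treeHt htree b ∧ ¬ a ≤ b ∧ ¬ b ≤ a)
    (yfin : Finset T)
    (hy : ∀ n : ℕ, ∀ a ∈ y n, ∀ b ∈ yfin, treeHt htree a < treeHt htree b) :
    ∃ n : ℕ, ∀ a ∈ y n, ∀ b ∈ yfin, ¬ a ≤ b ∧ ¬ b ≤ a := by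
  by_contra! hcon
  have hbelow : ∀ n, ∃ b : yfin, ∃ a ∈ y n, a < (b : T) := by
    intro n
    obtain ⟨a, ha, b, hb, hab⟩ := hcon n
    have hht := hy n a ha b hb
    have hba : ¬ b ≤ a := fun hle => (treeHt_mono htree hle).not_gt hht
    have hle : a ≤ b := by_contra fun hnle => hba (hab hnle)
    exact ⟨⟨b, hb⟩, a, ha, lt_of_le_not_ge hle hba⟩
  choose f g hg hgf using hbelow
  obtain ⟨m, n, hmn, hf⟩ : ∃ m n, m < n ∧ f m = f n := by
    obtain ⟨m, n, hne, hf⟩ := Finite.exists_ne_map_eq_of_infinite f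
    rcases hne.lt_or_gt with hlt | hgt
    · exact ⟨m, n, hlt, hf⟩
    · exact ⟨n, m, hgt, hf.symm⟩
  obtain ⟨-, hmn₁, hmn₂⟩ := hseq m n hmn (g m) (hg m) (g n) (hg n)
  exact (htree.le_or_le_of_lt (hgf m) (hf ▸ hgf n)).elim hmn₁ hmn₂
end
end

section
/- ◊* implies that there exists a partial order which is Knaster but not stationarily Knaster. -/
noncomputable section

open Set

/-- Two conditions are compatible if they have a common lower bound. -/
def Compat {P : Type*} [PartialOrder P] (p q : P) : Prop := ∃ r, r ≤ p ∧ r ≤ q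

/-- A set of conditions is linked if its elements are pairwise compatible. -/
def Linked {P : Type*} [PartialOrder P] (B : Set P) : Prop :=
  ∀ p ∈ B, ∀ q ∈ B, Compat p q

/-- A set of conditions is centered if each of its finite subsets has a lower bound. -/
def Centered {P : Type*} [PartialOrder P] (B : Set P) : Prop :=
  ∀ F : Finset P, ↑F ⊆ B → ∃ r : P, ∀ p ∈ F, r ≤ p

/-- `P` is stationarily Knaster. -/
def StationarilyKnaster (P : Type*) [PartialOrder P] : Prop :=
  ∀ S : Set Ordinal, IsStationaryOmega1 S → ∀ p : Ordinal → P,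
    ∃ T ⊆ S, IsStationaryOmega1 T ∧ ∀ i ∈ T, ∀ j ∈ T, Compat (p i) (p j)

/-- `P` has stationary precaliber `ω₁`. -/
def StationaryPrecaliber (P : Type*) [PartialOrder P] : Prop :=
  ∀ S : Set Ordinal, IsStationaryOmega1 S → ∀ p : Ordinal → P,
    ∃ T ⊆ S, IsStationaryOmega1 T ∧ Centered (p '' T)

/-- `P` is Knaster: every family of ℵ₁-many conditions has an uncountable
linked subfamily. -/
def Knaster (P : Type*) [PartialOrder P] : Prop :=
  ∀ p : Ordinal → P, ∃ X ⊆ Set.Iio omega1, ¬ X.Countable ∧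
    ∀ i ∈ X, ∀ j ∈ X, Compat (p i) (p j)

/-- The principle ◊*. -/
def DiamondStar : Prop :=
  ∃ 𝒮 : Ordinal → Set (Set Ordinal),
    (∀ α < omega1, (𝒮 α).Countable ∧ ∀ s ∈ 𝒮 α, s ⊆ Set.Iio α) ∧
    ∀ X : Set Ordinal, X ⊆ Set.Iio omega1 →
      ∃ D, IsClubOmega1 D ∧ ∀ α ∈ D, X ∩ Set.Iio α ∈ 𝒮 α

theorem omega1_eq : omega1 = Ordinal.omega 1 := Cardinal.ord_aleph 1

theorem countable_Iio_of_lt_omega1 {α : Ordinal} (hα : α < omega1) : (Iio α).Countable := by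
  rw [← Cardinal.le_aleph0_iff_set_countable, Cardinal.mk_Iio_ordinal, ← Cardinal.lift_aleph0.{1, 0},
    Cardinal.lift_le, ← Cardinal.lt_aleph_one_iff]
  exact Cardinal.lt_ord.1 hα

theorem isSuccLimit_omega1 : Order.IsSuccLimit omega1 :=
  Cardinal.isSuccLimit_ord (Cardinal.aleph0_le_aleph 1)

theorem add_one_lt_omega1 {α : Ordinal} (hα : α < omega1) : α + 1 < omega1 :=
  isSuccLimit_omega1.add_one_lt hα

/-- A countable family of countable ordinals is bounded below `ω₁`. -/
theorem exists_bound_of_countable {s : Set Ordinal} (hs : s.Countable) (h : s ⊆ Iio omega1) :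
    ∃ b < omega1, ∀ x ∈ s, x ≤ b := by
  have := hs.to_subtype
  refine ⟨⨆ x : s, x.1, ?_, fun x hx => ?_⟩
  · have := Ordinal.iSup_lt_omega_one (f := fun x : s => x.1) fun x => omega1_eq ▸ h x.2
    rwa [← omega1_eq] at this
  · refine le_ciSup (f := fun x : s => x.1) ⟨omega1, ?_⟩ ⟨x, hx⟩
    rintro _ ⟨y, rfl⟩
    exact (h y.2).le

theorem not_countable_of_unbounded {s : Set Ordinal} (h : s ⊆ Iio omega1)
    (hu : ∀ β < omega1, ∃ γ ∈ s, β < γ) : ¬ s.Countable := fun hs => by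
  obtain ⟨b, hb, hle⟩ := exists_bound_of_countable hs h
  obtain ⟨γ, hγ, hlt⟩ := hu b hb
  exact (hle γ hγ).not_gt hlt

/-- The nonzero countable ordinals closed under the function `b`. -/
def closurePoints (b : Ordinal → Ordinal) : Set Ordinal :=
  {α | α < omega1 ∧ α ≠ 0 ∧ ∀ γ < α, b γ < α}

theorem isClub_closurePoints {b : Ordinal → Ordinal} (hb : ∀ γ < omega1, b γ < omega1) :
    IsClubOmega1 (closurePoints b) := by
  refine ⟨fun α h => h.1, fun α hα => ?_, fun α hα h0 h => ⟨hα, h0, fun γ hγ => ?_⟩⟩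
  · have step : ∀ δ : Ordinal, ∃ ε, δ < omega1 → ε < omega1 ∧ δ < ε ∧ ∀ γ ≤ δ, b γ < ε := by
      intro δ
      by_cases hδ : δ < omega1
      · obtain ⟨c, hc, hle⟩ := exists_bound_of_countable
          (s := insert δ (b '' Iio (δ + 1)))
          (((countable_Iio_of_lt_omega1 (add_one_lt_omega1 hδ)).image b).insert δ) (by
            rintro _ (rfl | ⟨γ, hγ, rfl⟩)
            · exact hδ
            · exact hb γ (lt_trans hγ (add_one_lt_omega1 hδ)))
        refine ⟨c + 1, fun _ => ⟨add_one_lt_omega1 hc, ?_, fun γ hγ => ?_⟩⟩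
        · exact Order.lt_add_one_iff.2 (hle δ (mem_insert _ _))
        · exact Order.lt_add_one_iff.2 (hle _ (mem_insert_of_mem _
            ⟨γ, Order.lt_add_one_iff.2 hγ, rfl⟩))
      · exact ⟨0, fun h => absurd h hδ⟩
    choose g hg using step
    have hlt : ∀ n : ℕ, g^[n] α < omega1 := by
      intro n
      induction n with
      | zero => exact hα
      | succ n ih => rw [Function.iterate_succ_apply']; exact (hg _ ih).1
    have hbdd : BddAbove (range fun n : ℕ => g^[n] α) := ⟨omega1, by
      rintro _ ⟨n, rfl⟩
      exact (hlt n).le⟩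
    have hαlt : α < ⨆ n : ℕ, g^[n] α :=
      (hg α hα).2.1.trans_le (le_ciSup hbdd 1)
    refine ⟨⨆ n : ℕ, g^[n] α, ⟨?_, hαlt.ne_bot, fun γ hγ => ?_⟩, hαlt⟩
    · have := Ordinal.iSup_lt_omega_one (f := fun n : ℕ => g^[n] α) fun n => omega1_eq ▸ hlt n
      rwa [← omega1_eq] at this
    · obtain ⟨n, hn⟩ := exists_lt_of_lt_ciSup hγ
      refine ((hg _ (hlt n)).2.2 γ hn.le).trans_le ?_
      have := le_ciSup hbdd (n + 1)
      rwa [Function.iterate_succ_apply'] at this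
  · obtain ⟨δ, hδ, h1, h2⟩ := h γ hγ
    exact (hδ.2.2 γ h1).trans h2

/-- A weak form of the pressing down lemma. -/
theorem exists_uncountable_of_regressive {b : Ordinal → Ordinal}
    (hb : ∀ γ < omega1, b γ < omega1) {i₀ : Ordinal} (hi₀ : i₀ < omega1)
    {R : Ordinal → Ordinal → Prop}
    (hR : ∀ i ∈ closurePoints b, i₀ < i → ∃ γ < i, R i γ) :
    ∃ γ < omega1, ¬ {i ∈ closurePoints b | i₀ < i ∧ R i γ}.Countable := by
  by_contra! hcon
  have hbd : ∀ γ : Ordinal, ∃ c, γ < omega1 → c < omega1 ∧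
      ∀ i ∈ closurePoints b, i₀ < i → R i γ → i ≤ c := by
    intro γ
    by_cases hγ : γ < omega1
    · obtain ⟨c, hc, hle⟩ := exists_bound_of_countable (hcon γ hγ) fun i hi => hi.1.1
      exact ⟨c, fun _ => ⟨hc, fun i hi h0 h => hle i ⟨hi, h0, h⟩⟩⟩
    · exact ⟨0, fun h => absurd h hγ⟩
  choose c hc using hbd
  obtain ⟨i, ⟨hi, h0, hcl⟩, hlt⟩ := (isClub_closurePoints (b := fun γ => max (b γ) (c γ))
    fun γ hγ => max_lt (hb γ hγ) (hc γ hγ).1).2.1 i₀ hi₀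
  have hib : i ∈ closurePoints b := ⟨hi, h0, fun γ hγ => (max_lt_iff.1 (hcl γ hγ)).1⟩
  obtain ⟨γ, hγ, hRγ⟩ := hR i hib hlt
  exact ((hc γ (hγ.trans hi)).2 i hib hlt hRγ).not_gt (max_lt_iff.1 (hcl γ hγ)).2

theorem exists_bound_of_finite {s : Set Ordinal} (hs : s.Finite) {i : Ordinal} (hi : i ≠ 0)
    (h : s ⊆ Iio i) : ∃ γ < i, ∀ x ∈ s, x ≤ γ := by
  rcases s.eq_empty_or_nonempty with rfl | hne
  · exact ⟨0, pos_iff_ne_zero.2 hi, by simp⟩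
  · obtain ⟨m, hm, hmax⟩ := hs.exists_maximalFor id s hne
    exact ⟨m, h hm, fun x hx => (le_total x m).elim id fun hle => hmax hx hle⟩

/-- A subset of `α`, finite below each `β < α`, that meets each of countably many unbounded
subsets of `α`. -/
theorem exists_ladder {α : Ordinal} (hα : α < omega1) {𝒮 : Set (Set Ordinal)}
    (h𝒮 : 𝒮.Countable) :
    ∃ A : Set Ordinal, (∀ β < α, (A ∩ Iio β).Finite) ∧
      ∀ s ∈ 𝒮, α ≠ 0 → (∀ β < α, ∃ γ ∈ s, β < γ) → (A ∩ s).Nonempty := by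
  rcases eq_or_ne α 0 with rfl | h0
  · exact ⟨∅, by simp, by simp⟩
  rcases {s ∈ 𝒮 | ∀ β < α, ∃ γ ∈ s, β < γ}.eq_empty_or_nonempty with he | hne
  · refine ⟨∅, by simp, fun s hs _ hu => ?_⟩
    exact absurd (show s ∈ {s ∈ 𝒮 | ∀ β < α, ∃ γ ∈ s, β < γ} from ⟨hs, hu⟩) (by simp [he])
  obtain ⟨s, hs⟩ := (h𝒮.mono (sep_subset _ _)).exists_eq_range hne
  obtain ⟨e, he⟩ := (countable_Iio_of_lt_omega1 hα).exists_eq_range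
    ⟨0, pos_iff_ne_zero.2 h0⟩
  have hsel : ∀ n : ℕ, ∃ a ∈ s n, ∀ m ≤ n, e m ≤ a := by
    intro n
    obtain ⟨γ, hγ, hle⟩ := exists_bound_of_finite ((finite_le_nat n).image e) h0 (by
      rintro _ ⟨m, -, rfl⟩
      exact he ▸ mem_range_self m)
    obtain ⟨a, ha, hlt⟩ := (hs ▸ mem_range_self n : s n ∈ {s ∈ 𝒮 | ∀ β < α, ∃ γ ∈ s, β < γ}).2 γ hγ
    exact ⟨a, ha, fun m hm => (hle _ ⟨m, hm, rfl⟩).trans hlt.le⟩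
  choose a ha hle using hsel
  refine ⟨range a, fun β hβ => ?_, fun t ht _ hu => ?_⟩
  · obtain ⟨m, rfl⟩ : β ∈ range e := he ▸ hβ
    refine ((finite_lt_nat m).image a).subset ?_
    rintro _ ⟨⟨n, rfl⟩, hn⟩
    exact ⟨n, lt_of_not_ge fun hmn => (hle n m hmn).not_gt hn, rfl⟩
  · obtain ⟨n, rfl⟩ : t ∈ range s := hs ▸ ⟨ht, hu⟩
    exact ⟨a n, mem_range_self n, ha n⟩

/-- Finite sets of countable ordinals without a pair `β < α` such that `β ∈ A α`. -/
def IsFree (A : Ordinal → Set Ordinal) (F : Finset Ordinal) : Prop :=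
  ∀ α ∈ F, α < omega1 ∧ ∀ β ∈ F, β < α → β ∉ A α

/-- The poset of finite `A`-free sets, ordered by reverse inclusion. -/
abbrev FreePoset (A : Ordinal → Set Ordinal) : Type 1 := {F : Finset Ordinal // IsFree A F}ᵒᵈ

theorem compat_freePoset_iff {A : Ordinal → Set Ordinal} {p q : FreePoset A} :
    Compat p q ↔ ∀ α ∈ (p.ofDual : Finset Ordinal), ∀ β ∈ (q.ofDual : Finset Ordinal),
      (β < α → β ∉ A α) ∧ (α < β → α ∉ A β) := by
  classical
  refine ⟨fun ⟨r, hp, hq⟩ α hα β hβ => ?_, fun h => ?_⟩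
  · have hα' := hp hα
    have hβ' := hq hβ
    exact ⟨(r.ofDual.2 α hα').2 β hβ', (r.ofDual.2 β hβ').2 α hα'⟩
  · refine ⟨OrderDual.toDual ⟨p.ofDual.1 ∪ q.ofDual.1, fun α hα => ?_⟩,
      Finset.subset_union_left, Finset.subset_union_right⟩
    rcases Finset.mem_union.1 hα with hα | hα
    · refine ⟨(p.ofDual.2 α hα).1, fun β hβ => ?_⟩
      rcases Finset.mem_union.1 hβ with hβ | hβ
      · exact (p.ofDual.2 α hα).2 β hβ
      · exact (h α hα β hβ).1
    · refine ⟨(q.ofDual.2 α hα).1, fun β hβ => ?_⟩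
      rcases Finset.mem_union.1 hβ with hβ | hβ
      · exact (h β hβ α hα).2
      · exact (q.ofDual.2 α hα).2 β hβ

theorem Compat.symm {P : Type*} [PartialOrder P] {p q : P} (h : Compat p q) : Compat q p :=
  let ⟨r, hp, hq⟩ := h
  ⟨r, hq, hp⟩

/-- All but boundedly many `i` are omitted by some later member of a family of finite sets. -/
theorem exists_bound_forall_exists_notMem (p : Ordinal → Finset Ordinal) :
    ∃ i₀ < omega1, ∀ i < omega1, i₀ < i → ∃ k < omega1, i ≤ k ∧ i ∉ p k := by
  have hfin : {i | i < omega1 ∧ ∀ k < omega1, i ≤ k → i ∈ p k}.Finite := by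
    by_contra hinf
    let f := Set.Infinite.natEmbedding _ hinf
    obtain ⟨k, hk, hle⟩ := exists_bound_of_countable
      (countable_range fun n => (f n).1) (by rintro _ ⟨n, rfl⟩; exact (f n).2.1)
    refine Set.infinite_range_of_injective (f := fun n => (f n).1)
      (Subtype.val_injective.comp f.injective) ((p k).finite_toSet.subset ?_)
    rintro _ ⟨n, rfl⟩
    exact (f n).2.2 k hk (hle _ ⟨n, rfl⟩)
  obtain ⟨i₀, hi₀, hle⟩ := exists_bound_of_countable hfin.countable fun i hi => hi.1
  refine ⟨i₀, hi₀, fun i hi hlt => ?_⟩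
  by_contra! h
  exact (hle i ⟨hi, h⟩).not_gt hlt

theorem knaster_freePoset {A : Ordinal → Set Ordinal}
    (hA : ∀ α < omega1, ∀ β < α, (A α ∩ Iio β).Finite) : Knaster (FreePoset A) := by
  intro p
  let F : Ordinal → Finset Ordinal := fun i => (p i).ofDual
  have hF : ∀ i, IsFree A (F i) := fun i => (p i).ofDual.2
  obtain ⟨i₀, hi₀, hex⟩ := exists_bound_forall_exists_notMem F
  have hex' : ∀ i, ∃ k, i < omega1 → k < omega1 ∧ (i₀ < i → i ≤ k ∧ i ∉ F k) := by
    intro i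
    by_cases hi : i < omega1 ∧ i₀ < i
    · obtain ⟨k, hk, h⟩ := hex i hi.1 hi.2
      exact ⟨k, fun _ => ⟨hk, fun _ => h⟩⟩
    · exact ⟨0, fun h => ⟨pos_iff_ne_zero.2 hi₀.ne_bot, fun h' => absurd ⟨h, h'⟩ hi⟩⟩
  choose h hh using hex'
  have hbound : ∀ i, ∃ b, i < omega1 → b < omega1 ∧ h i ≤ b ∧ ∀ x ∈ F (h i), x ≤ b := by
    intro i
    by_cases hi : i < omega1
    · obtain ⟨b, hb, hle⟩ := exists_bound_of_countable (s := insert (h i) (F (h i) : Set Ordinal))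
        ((F (h i)).finite_toSet.countable.insert _) (by
          rintro x (rfl | hx)
          · exact (hh i hi).1
          · exact (hF _ x hx).1)
      exact ⟨b, fun _ => ⟨hb, hle _ (mem_insert _ _), fun x hx => hle x (mem_insert_of_mem _ hx)⟩⟩
    · exact ⟨0, fun h => absurd h hi⟩
  choose b hb using hbound
  have hb' : ∀ γ < omega1, b γ < omega1 := fun γ hγ => (hb γ hγ).1
  obtain ⟨γ, hγ, hunc⟩ := exists_uncountable_of_regressive hb' hi₀
    (R := fun i γ => (∀ x ∈ F (h i), x < i → x ≤ γ) ∧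
      ∀ α ∈ F (h i), i < α → ∀ x ∈ A α, x < i → x ≤ γ) (by
    intro i hi hlt
    have hfin : ((F (h i) : Set Ordinal) ∩ Iio i ∪
        ⋃ α ∈ {α ∈ (F (h i) : Set Ordinal) | i < α}, A α ∩ Iio i).Finite := by
      refine ((F (h i)).finite_toSet.inter_of_left _).union (Set.Finite.biUnion
        ((F (h i)).finite_toSet.subset (sep_subset _ _)) fun α hα => ?_)
      exact hA α (hF _ α hα.1).1 i hα.2
    obtain ⟨γ, hγ, hle⟩ := exists_bound_of_finite hfin hi.2.1 (by
      rintro x (hx | hx)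
      · exact hx.2
      · simp only [mem_iUnion] at hx
        obtain ⟨α, _, hx⟩ := hx
        exact hx.2)
    refine ⟨γ, hγ, fun x hx hxi => hle x (Or.inl ⟨hx, hxi⟩), fun α hα hiα x hx hxi => ?_⟩
    exact hle x (Or.inr (mem_biUnion (show α ∈ {α ∈ (F (h i) : Set Ordinal) | i < α} from
      ⟨hα, hiα⟩) ⟨hx, hxi⟩)))
  set X := {i ∈ closurePoints b | i₀ < i ∧ (∀ x ∈ F (h i), x < i → x ≤ γ) ∧
      ∀ α ∈ F (h i), i < α → ∀ x ∈ A α, x < i → x ≤ γ}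
  obtain ⟨r, hr⟩ : ∃ r : Set Ordinal,
      ¬ {i ∈ X | γ < i ∧ (F (h i) : Set Ordinal) ∩ Iio i = r}.Countable := by
    by_contra! hcon
    have hcount := countable_ofPred_finite_subset
      (countable_Iio_of_lt_omega1 (add_one_lt_omega1 hγ))
    refine hunc (((hcount.biUnion fun r _ => hcon r).union
      (countable_Iio_of_lt_omega1 (add_one_lt_omega1 hγ))).mono fun i hi => ?_)
    by_cases hγi : γ < i
    · refine Or.inl (mem_biUnion (show (F (h i) : Set Ordinal) ∩ Iio i ∈ _ from
        ⟨(F (h i)).finite_toSet.inter_of_left _, fun x hx => ?_⟩) ⟨hi, hγi, rfl⟩)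
      exact Order.lt_add_one_iff.2 (hi.2.2.1 x hx.1 hx.2)
    · exact Or.inr (Order.lt_add_one_iff.2 (not_lt.1 hγi))
  set Y := {i ∈ X | γ < i ∧ (F (h i) : Set Ordinal) ∩ Iio i = r}
  have hinj : InjOn h Y := by
    have key : ∀ i ∈ Y, ∀ j ∈ Y, j < i → h j < h i := fun i hi j hj hlt =>
      ((hb j hj.1.1.1).2.1.trans_lt (hi.1.1.2.2 j hlt)).trans_le
        ((hh i hi.1.1.1).2 hi.1.2.1).1
    intro i hi j hj heq
    rcases lt_trichotomy i j with hlt | rfl | hlt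
    · exact absurd heq (key j hj i hi hlt).ne
    · rfl
    · exact absurd heq (key i hi j hj hlt).ne'
  have hmain : ∀ i ∈ Y, ∀ j ∈ Y, j ≤ i → Compat (p (h i)) (p (h j)) := by
    intro i hi j hj hji
    rcases hji.eq_or_lt with rfl | hji
    · exact ⟨_, le_rfl, le_rfl⟩
    have hsub : ∀ x ∈ F (h j), x < i := fun x hx =>
      ((hb j hj.1.1.1).2.2 x hx).trans_lt (hi.1.1.2.2 j hji)
    rw [compat_freePoset_iff]
    intro α (hα : α ∈ F (h i)) β (hβ : β ∈ F (h j))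
    by_cases hαi : α < i
    · have : α ∈ (F (h j) : Set Ordinal) ∩ Iio j := by
        rw [hj.2.2, ← hi.2.2]
        exact ⟨hα, hαi⟩
      exact ⟨(hF _ α this.1).2 β hβ, (hF _ β hβ).2 α this.1⟩
    · have hβi := hsub β hβ
      have hiα : i < α := lt_of_le_of_ne (not_lt.1 hαi) (by
        rintro rfl
        exact ((hh i hi.1.1.1).2 hi.1.2.1).2 hα)
      refine ⟨fun hlt hmem => ?_, fun hlt => absurd (hlt.trans hβi) hαi⟩
      have hβγ := hi.1.2.2.2 α hα hiα β hmem hβi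
      have : β ∈ (F (h i) : Set Ordinal) ∩ Iio i := by
        rw [hi.2.2, ← hj.2.2]
        exact ⟨hβ, hβγ.trans_lt hj.2.1⟩
      exact (hF _ α hα).2 β this.1 hlt hmem
  refine ⟨h '' Y, ?_, fun hc => hr (countable_of_injective_of_countable_image hinj hc), ?_⟩
  · rintro _ ⟨i, hi, rfl⟩
    exact (hh i hi.1.1.1).1
  · rintro _ ⟨i, hi, rfl⟩ _ ⟨j, hj, rfl⟩
    rcases le_total j i with hji | hij
    · exact hmain i hi j hj hji
    · exact (hmain j hj i hi hij).symm

theorem isStationary_Iio_omega1 : IsStationaryOmega1 (Iio omega1) := by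
  refine ⟨subset_rfl, fun C hC => ?_⟩
  obtain ⟨β, hβ, -⟩ := hC.2.1 0 isSuccLimit_omega1.bot_lt
  exact ⟨β, hC.1 hβ, hβ⟩

theorem IsStationaryOmega1.unbounded {T : Set Ordinal} (hT : IsStationaryOmega1 T)
    {β : Ordinal} (hβ : β < omega1) : ∃ γ ∈ T, β < γ := by
  have hclub : IsClubOmega1 (Ioo β omega1) := by
    refine ⟨fun _ h => h.2, fun α hα => ?_, fun α hα h0 hl => ?_⟩
    · exact ⟨max α β + 1, ⟨Order.lt_add_one_iff.2 (le_max_right _ _),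
        add_one_lt_omega1 (max_lt hα hβ)⟩, Order.lt_add_one_iff.2 (le_max_left _ _)⟩
    · obtain ⟨γ, hγ, -, hlt⟩ := hl 0 (pos_iff_ne_zero.2 h0)
      exact ⟨hγ.1.trans hlt, hα⟩
  obtain ⟨γ, hγT, hγ⟩ := hT.2 _ hclub
  exact ⟨γ, hγT, hγ.1⟩

theorem not_stationarilyKnaster_freePoset {A : Ordinal → Set Ordinal}
    (hA : ∀ T, IsStationaryOmega1 T → ∃ α ∈ T, ∃ β ∈ T, β < α ∧ β ∈ A α) :
    ¬ StationarilyKnaster (FreePoset A) := by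
  classical
  intro hK
  have hfree : ∀ α < omega1, IsFree A {α} := by
    intro α hα x hx
    obtain rfl := Finset.mem_singleton.1 hx
    exact ⟨hα, fun β hβ hlt => absurd (Finset.mem_singleton.1 hβ) hlt.ne⟩
  obtain ⟨T, hTS, hT, hcompat⟩ := hK _ isStationary_Iio_omega1 fun α =>
    if hα : α < omega1 then OrderDual.toDual ⟨{α}, hfree α hα⟩
    else OrderDual.toDual ⟨∅, fun x hx => absurd hx (Finset.notMem_empty x)⟩
  obtain ⟨α, hα, β, hβ, hlt, hmem⟩ := hA T hT
  have hc := hcompat α hα β hβ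
  rw [dif_pos (mem_Iio.1 (hTS hα)), dif_pos (mem_Iio.1 (hTS hβ)), compat_freePoset_iff] at hc
  exact (hc α (Finset.mem_singleton_self α) β (Finset.mem_singleton_self β)).1 hlt hmem

theorem DiamondStar.exists_ladder_system (h : DiamondStar) :
    ∃ A : Ordinal → Set Ordinal, (∀ α < omega1, ∀ β < α, (A α ∩ Iio β).Finite) ∧
      ∀ T, IsStationaryOmega1 T → ∃ α ∈ T, ∃ β ∈ T, β < α ∧ β ∈ A α := by
  obtain ⟨𝒮, h𝒮, hguess⟩ := h
  have hlad : ∀ α, ∃ A : Set Ordinal, α < omega1 → (∀ β < α, (A ∩ Iio β).Finite) ∧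
      ∀ s ∈ 𝒮 α, α ≠ 0 → (∀ β < α, ∃ γ ∈ s, β < γ) → (A ∩ s).Nonempty := by
    intro α
    by_cases hα : α < omega1
    · obtain ⟨A, hA⟩ := exists_ladder hα (h𝒮 α hα).1
      exact ⟨A, fun _ => hA⟩
    · exact ⟨∅, fun h => absurd h hα⟩
  choose A hA using hlad
  refine ⟨A, fun α hα => (hA α hα).1, fun T hT => ?_⟩
  obtain ⟨D, hD, hDT⟩ := hguess T hT.1
  have hnext : ∀ γ : Ordinal, ∃ t d, γ < omega1 → t ∈ T ∧ γ < t ∧ d ∈ D ∧ γ < d := by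
    intro γ
    by_cases hγ : γ < omega1
    · obtain ⟨t, ht, h1⟩ := hT.unbounded hγ
      obtain ⟨d, hd, h2⟩ := hD.2.1 γ hγ
      exact ⟨t, d, fun _ => ⟨ht, h1, hd, h2⟩⟩
    · exact ⟨0, 0, fun h => absurd h hγ⟩
  choose t d htd using hnext
  obtain ⟨α, hαT, hα, h0, hcl⟩ := hT.2 _ (isClub_closurePoints
    (b := fun γ => max (t γ) (d γ)) fun γ hγ =>
      max_lt (hT.1 (htd γ hγ).1) (hD.1 (htd γ hγ).2.2.1))
  have hαD : α ∈ D := hD.2.2 α hα h0 fun β hβ =>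
    have hβ' := htd β (hβ.trans hα)
    ⟨d β, hβ'.2.2.1, hβ'.2.2.2, (max_lt_iff.1 (hcl β hβ)).2⟩
  obtain ⟨β, hβA, hβT, hβα⟩ := (hA α hα).2 _ (hDT α hαD) h0 fun β hβ =>
    have hβ' := htd β (hβ.trans hα)
    ⟨t β, ⟨hβ'.1, (max_lt_iff.1 (hcl β hβ)).1⟩, hβ'.2.1⟩
  exact ⟨α, hαT, β, hβT, hβα, hβA⟩

/-- ◊* implies that there exists a partial order which is Knaster but not
stationarily Knaster. -/
theorem diamondStar_implies_Knaster_not_stationarily_Knaster (h : DiamondStar) :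
    ∃ (P : Type 1) (inst : PartialOrder P),
      @Knaster P inst ∧ ¬ @StationarilyKnaster P inst := by
  obtain ⟨A, hfin, hT⟩ := h.exists_ladder_system
  exact ⟨FreePoset A, inferInstance, knaster_freePoset hfin, not_stationarilyKnaster_freePoset hT⟩
end
end

section
/- Let T* be an ω₁-Aronszajn tree with no stationary antichain. Then the partial order P whose conditions are finite antichains of T*, ordered by reverse inclusion, is not stationarily Knaster. -/
noncomputable section

open Set

/-- The forcing of finite antichains of a tree, ordered by reverse inclusion. -/
def FinAntichainPoset (T : Type) [PartialOrder T] : Type :=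
  {A : Finset T // IsAntichain (· ≤ ·) (A : Set T)}

instance (T : Type) [PartialOrder T] : PartialOrder (FinAntichainPoset T) where
  le q p := p.1 ⊆ q.1
  le_refl p := Finset.Subset.refl _
  le_trans a b c hab hbc := Finset.Subset.trans hbc hab
  le_antisymm a b hab hba := Subtype.ext (Finset.Subset.antisymm hba hab)

theorem zero_lt_omega1 : 0 < omega1 :=
  Cardinal.ord_pos.2 (Cardinal.aleph_pos 1)

theorem isStationaryOmega1_Iio : IsStationaryOmega1 (Set.Iio omega1) := by
  refine ⟨Subset.rfl, fun C hC => ?_⟩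
  obtain ⟨β, hβ, -⟩ := hC.2.1 0 zero_lt_omega1
  exact ⟨β, hC.1 hβ, hβ⟩

/-- If T* is an ω₁-Aronszajn tree with no stationary antichain, then the poset
of finite antichains of T* ordered by reverse inclusion is not stationarily
Knaster. -/
theorem finAntichainPoset_not_stationarily_Knaster
    (T : Type) [PartialOrder T] (htree : IsTree T)
    (hlt : ∀ x : T, treeHt htree x < omega1)
    (hunb : ∀ α < omega1, ∃ x : T, treeHt htree x = α)
    (hlevels : ∀ α : Ordinal, {x : T | treeHt htree x = α}.Countable)
    (haron : ∀ C : Set T, IsChain (· ≤ ·) C → C.Countable)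
    (hnostat : ¬ ∃ A : Set T, IsAntichain (· ≤ ·) A ∧
      IsStationaryOmega1 (treeHt htree '' A)) :
    ¬ StationarilyKnaster (FinAntichainPoset T) := by
  intro hK
  have hchoose : ∀ α : Ordinal, ∃ x : T, α < omega1 → treeHt htree x = α := by
    intro α
    by_cases hα : α < omega1
    · obtain ⟨x, hx⟩ := hunb α hα
      exact ⟨x, fun _ => hx⟩
    · obtain ⟨x, -⟩ := hunb 0 zero_lt_omega1
      exact ⟨x, fun h => absurd h hα⟩
  choose x hx using hchoose
  obtain ⟨B, -, hB, hcompat⟩ := hK (Set.Iio omega1) isStationaryOmega1_Iio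
    (fun α => ⟨{x α}, by simp⟩)
  refine hnostat ⟨x '' B, ?_, ?_⟩
  · rintro _ ⟨α, hα, rfl⟩ _ ⟨β, hβ, rfl⟩ hne
    obtain ⟨r, hrα, hrβ⟩ := hcompat α hα β hβ
    exact r.2 (hrα (Finset.mem_singleton_self _)) (hrβ (Finset.mem_singleton_self _)) hne
  · have himage : treeHt htree '' (x '' B) = B := by
      rw [Set.image_image]
      exact (Set.image_congr fun α hα => hx α (hB.1 hα)).trans (Set.image_id' B)
    rwa [himage]
end
end

section
/- Let 𝓘 be a P-ideal over an uncountable set S whose members are countable subsets of S and which contains all finite subsets of S. Let K ⊆ 𝓘 be cofinal and x ∈ 𝓘. Then there exists a finite set x₀ ⊆ x such that K↾(x \ x₀) is cofinal in 𝓘. -/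
noncomputable section

open Set

/-- `I` is a P-ideal of countable subsets of `S` containing all finite sets. -/
def IsPIdeal {S : Type*} (I : Set (Set S)) : Prop :=
  (∀ a ∈ I, a.Countable) ∧
  (∀ a ∈ I, ∀ b : Set S, b ⊆ a → b ∈ I) ∧
  (∀ a ∈ I, ∀ b ∈ I, a ∪ b ∈ I) ∧
  (∀ a : Set S, a.Finite → a ∈ I) ∧
  (∀ A : ℕ → Set S, (∀ n, A n ∈ I) → ∃ B ∈ I, ∀ n, (A n \ B).Finite)

/-- `K` is a cofinal subset of the ideal `I` (with respect to ⊆*). -/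
def CofinalIn {S : Type*} (I K : Set (Set S)) : Prop :=
  K ⊆ I ∧ ∀ a ∈ I, ∃ b ∈ K, (a \ b).Finite

/-- For a cofinal K ⊆ 𝓘 and x ∈ 𝓘 there is a finite x₀ ⊆ x such that
K↾(x \ x₀) is cofinal in 𝓘. -/
theorem cofinal_restriction (S : Type*) (hS : ¬ Countable S)
    (I : Set (Set S)) (hI : IsPIdeal I)
    (K : Set (Set S)) (hK : CofinalIn I K)
    (x : Set S) (hx : x ∈ I) :
    ∃ x₀ : Set S, x₀ ⊆ x ∧ x₀.Finite ∧
      CofinalIn I {b ∈ K | x \ x₀ ⊆ b} := by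
  obtain ⟨hcount, -, hunion, -, hP⟩ := hI
  by_contra! hcon
  have hbad : ∀ t : {t : Set S // t.Finite ∧ t ⊆ x},
      ∃ a ∈ I, ∀ b ∈ K, x \ t.1 ⊆ b → ¬ (a \ b).Finite := by
    rintro ⟨t, htfin, htx⟩
    by_contra! h
    refine hcon t htx htfin ⟨fun b hb => hK.1 hb.1, fun a ha => ?_⟩
    obtain ⟨b, hbK, hxb, hab⟩ := h a ha
    exact ⟨b, ⟨hbK, hxb⟩, hab⟩
  choose a haI ha using hbad
  have : Countable {t : Set S // t.Finite ∧ t ⊆ x} :=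
    (Set.countable_ofPred_finite_subset (hcount x hx)).to_subtype
  have : Nonempty {t : Set S // t.Finite ∧ t ⊆ x} :=
    ⟨⟨∅, Set.finite_empty, Set.empty_subset x⟩⟩
  obtain ⟨f, hf⟩ := exists_surjective_nat {t : Set S // t.Finite ∧ t ⊆ x}
  obtain ⟨B, hBI, hB⟩ := hP (fun n => a (f n)) fun n => haI (f n)
  obtain ⟨b, hbK, hb⟩ := hK.2 (B ∪ x) (hunion B hBI x hx)
  have hxb : (x \ b).Finite :=
    hb.subset (Set.sdiff_subset_sdiff_left Set.subset_union_right)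
  obtain ⟨n, hn⟩ := hf ⟨x \ b, hxb, Set.sdiff_subset⟩
  refine ha (f n) b hbK ?_ (((hB n).union hb).subset ?_)
  · rw [hn]
    intro y hy
    by_contra hyb
    exact hy.2 ⟨hy.1, hyb⟩
  · rintro y ⟨hya, hyb⟩
    by_cases hyB : y ∈ B
    · exact Or.inr ⟨Or.inl hyB, hyb⟩
    · exact Or.inl ⟨hya, hyB⟩
end
end

section
/- Let 𝓘 be a P-ideal over an uncountable set S whose members are countable subsets of S and which contains all finite subsets of S, and assume that S is not the union of countably many sets X with X ⊥ 𝓘. Let P be the partial order of pairs (a, X) with a ∈ 𝓘 and X a countable collection of cofinal subsets of 𝓘, where (b, Y) ≤ (a, X) iff a ⊆ b, X ⊆ Y, and K↾(b \ a) ∈ Y for every K ∈ X. Then for every p ∈ P and every countable set S₀ ⊆ S, there is q ≤ p such that a_q \ S₀ ≠ ∅ (writing p = (a_p, X_p)). -/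
noncomputable section

open Set

/-- X ⊥ 𝓘: no countably infinite subset of X belongs to 𝓘. -/
def OrthogonalTo {S : Type*} (I : Set (Set S)) (X : Set S) : Prop :=
  ∀ c : Set S, c ⊆ X → c.Countable → c.Infinite → c ∉ I

/-- Conditions of the P-ideal forcing: pairs (a, X) with a ∈ 𝓘 and X a countable
collection of cofinal subsets of 𝓘. -/
def PIdealCond {S : Type*} (I : Set (Set S)) (p : Set S × Set (Set (Set S))) : Prop :=
  p.1 ∈ I ∧ p.2.Countable ∧ ∀ K ∈ p.2, CofinalIn I K

/-- The order of the P-ideal forcing: (b, Y) ≤ (a, X) iff a ⊆ b, X ⊆ Y, and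
K↾(b \ a) ∈ Y for every K ∈ X. -/
def PIdealLe {S : Type*} (I : Set (Set S)) (q p : Set S × Set (Set (Set S))) : Prop :=
  p.1 ⊆ q.1 ∧ p.2 ⊆ q.2 ∧ ∀ K ∈ p.2, {c ∈ K | q.1 \ p.1 ⊆ c} ∈ q.2

/-- The points through which a cofinal set has no cofinal restriction form a set orthogonal
to the P-ideal. -/
theorem CofinalIn.orthogonalTo_setOf_not_cofinalIn {S : Type*} {I K : Set (Set S)}
    (hI : IsPIdeal I) (hK : CofinalIn I K) :
    OrthogonalTo I {x | ¬ CofinalIn I {c ∈ K | x ∈ c}} := by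
  obtain ⟨-, -, hunion, -, hP⟩ := hI
  intro c hcX hc hinf hcI
  obtain ⟨f, rfl⟩ := hc.exists_eq_range hinf.nonempty
  have hbad : ∀ n, ∃ a ∈ I, ∀ b ∈ K, f n ∈ b → ¬ (a \ b).Finite := by
    intro n
    by_contra! h
    refine hcX (mem_range_self n) ⟨fun b hb => hK.1 hb.1, fun a ha => ?_⟩
    obtain ⟨b, hbK, hfb, hfin⟩ := h a ha
    exact ⟨b, ⟨hbK, hfb⟩, hfin⟩
  choose A hAI hA using hbad
  obtain ⟨B, hBI, hB⟩ := hP A hAI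
  obtain ⟨b, hbK, hb⟩ := hK.2 _ (hunion B hBI _ hcI)
  obtain ⟨_, ⟨n, rfl⟩, hn⟩ :=
    (hinf.sdiff (hb.subset (sdiff_subset_sdiff_left subset_union_right))).nonempty
  have hfb : f n ∈ b := by
    by_contra h
    exact hn ⟨mem_range_self n, h⟩
  refine hA n b hbK hfb (((hB n).union hb).subset fun y hy => ?_)
  by_cases hyB : y ∈ B
  · exact Or.inr ⟨Or.inl hyB, hy.2⟩
  · exact Or.inl ⟨hy.1, hyB⟩

/-- If countably many orthogonal sets never cover `S`, some point avoids any given countable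
family of orthogonal sets. -/
theorem exists_notMem_of_countable_orthogonalTo {S : Type*} {I : Set (Set S)}
    (hcover : ¬ ∃ f : ℕ → Set S, (⋃ n, f n) = Set.univ ∧ ∀ n, OrthogonalTo I (f n))
    {F : Set (Set S)} (hF : F.Countable) (horth : ∀ X ∈ F, OrthogonalTo I X) :
    ∃ x, ∀ X ∈ F, x ∉ X := by
  by_contra! h
  obtain ⟨f, hf⟩ := (hF.insert ∅).exists_eq_range (insert_nonempty _ _)
  refine hcover ⟨f, eq_univ_of_forall fun x => ?_, fun n => ?_⟩
  · obtain ⟨X, hX, hx⟩ := h x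
    obtain ⟨n, rfl⟩ : X ∈ range f := hf ▸ mem_insert_of_mem _ hX
    exact mem_iUnion_of_mem n hx
  · have hn : f n ∈ insert ∅ F := hf ▸ mem_range_self n
    rcases hn with hn | hn
    · intro c hc _ hinf
      exact absurd (finite_empty.subset (hn ▸ hc)) hinf
    · exact horth _ hn

/-- In the P-ideal forcing, the working part of a condition can be extended
outside any prescribed countable set. -/
theorem pIdeal_forcing_extend_outside_countable
    (S : Type*) (hS : ¬ Countable S)
    (I : Set (Set S)) (hI : IsPIdeal I)
    (hcover : ¬ ∃ f : ℕ → Set S, (⋃ n, f n) = Set.univ ∧ ∀ n, OrthogonalTo I (f n))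
    (p : Set S × Set (Set (Set S))) (hp : PIdealCond I p)
    (S₀ : Set S) (hS₀ : S₀.Countable) :
    ∃ q : Set S × Set (Set (Set S)), PIdealCond I q ∧ PIdealLe I q p ∧
      (q.1 \ S₀).Nonempty := by
  obtain ⟨haI, hXc, hXcof⟩ := hp
  obtain ⟨x, hx⟩ := exists_notMem_of_countable_orthogonalTo (I := I) hcover
    (F := (fun K => {x | ¬ CofinalIn I {c ∈ K | x ∈ c}}) '' p.2 ∪ singleton '' S₀)
    ((hXc.image _).union (hS₀.image _)) (by
      rintro _ (⟨K, hK, rfl⟩ | ⟨y, -, rfl⟩)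
      · exact (hXcof K hK).orthogonalTo_setOf_not_cofinalIn hI
      · intro c hc _ hinf
        exact absurd ((finite_singleton y).subset hc) hinf)
  have hxS₀ : x ∉ S₀ := fun h => hx {x} (Or.inr ⟨x, h, rfl⟩) rfl
  have hxK : ∀ K ∈ p.2, CofinalIn I {c ∈ K | x ∈ c} := fun K hK =>
    not_not.1 (hx _ (Or.inl ⟨K, hK, rfl⟩))
  have hdiff : (p.1 ∪ {x}) \ p.1 ⊆ {x} := by
    rw [union_sdiff_left]
    exact sdiff_subset
  refine ⟨(p.1 ∪ {x}, p.2 ∪ (fun K => {c ∈ K | (p.1 ∪ {x}) \ p.1 ⊆ c}) '' p.2),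
    ⟨hI.2.2.1 _ haI _ (hI.2.2.2.1 _ (finite_singleton x)), hXc.union (hXc.image _), ?_⟩,
    ⟨subset_union_left, subset_union_left, fun K hK => Or.inr ⟨K, hK, rfl⟩⟩,
    ⟨x, Or.inr rfl, hxS₀⟩⟩
  rintro _ (hK | ⟨K, hK, rfl⟩)
  · exact hXcof _ hK
  · refine ⟨fun b hb => (hXcof K hK).1 hb.1, fun a ha => ?_⟩
    obtain ⟨b, ⟨hbK, hxb⟩, hfin⟩ := (hxK K hK).2 a ha
    exact ⟨b, ⟨hbK, hdiff.trans (singleton_subset_iff.2 hxb)⟩, hfin⟩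
end
end
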